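/- Fix two finite-horizon MDPs M=(S,A,P,r,H) and M'=(S,A,P',r,H) with the same states, actions, rewards, horizon and initial state s0, and possibly time-dependent dynamics P_h, P'_h. Let Δ = {(s,a,h) ∈ S×A×{0,…,H−1} : P_h(·|s,a) ≠ P'_h(·|s,a)}. Then for any policy π and any ρ > 0, if V^{M',π}_0(s0) − V^{M,*}_0(s0) > ρ, then P^M(τ_π ∩ Δ ≠ ∅) = P^{M'}(τ_π ∩ Δ ≠ ∅) > ρ/H, where τ_π ∩ Δ ≠ ∅ means that (s_h,a_h,h) ∈ Δ for some h < H. -/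

import Mathlib

open Finset

namespace MDPform

variable {S A : Type}

/-- Probability that a deterministic nonstationary policy `π`, run from `s0` for `H` steps
in an MDP with (time-dependent) dynamics `P`, produces the state trajectory `τ`. -/
def trajProb [Fintype S] [DecidableEq S] (P : ℕ → S → A → S → ℝ) (π : ℕ → S → A)
    (s0 : S) (H : ℕ) (τ : Fin (H + 1) → S) : ℝ :=
  (if τ 0 = s0 then (1 : ℝ) else 0) *
    ∏ h : Fin H, P h (τ h.castSucc) (π h (τ h.castSucc)) (τ h.succ)

/-- Sum of rewards along a trajectory. -/
def ret (r : S → A → ℝ) (π : ℕ → S → A) (H : ℕ) (τ : Fin (H + 1) → S) : ℝ :=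
  ∑ h : Fin H, r (τ h.castSucc) (π h (τ h.castSucc))

/-- Value `V^{M,π}_0(s0)` of policy `π`. -/
def value [Fintype S] [DecidableEq S] (P : ℕ → S → A → S → ℝ) (r : S → A → ℝ)
    (π : ℕ → S → A) (s0 : S) (H : ℕ) : ℝ :=
  ∑ τ : Fin (H + 1) → S, trajProb P π s0 H τ * ret r π H τ

/-- Optimal value `V^{M,*}_0(s0)`. -/
noncomputable def optValue [Fintype S] [DecidableEq S] (P : ℕ → S → A → S → ℝ)
    (r : S → A → ℝ) (s0 : S) (H : ℕ) : ℝ :=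
  ⨆ π : ℕ → S → A, value P r π s0 H

/-- Probability of a set of trajectories. -/
noncomputable def probEvent [Fintype S] [DecidableEq S] (P : ℕ → S → A → S → ℝ)
    (π : ℕ → S → A) (s0 : S) (H : ℕ) (E : Set (Fin (H + 1) → S)) : ℝ :=
  ∑ τ : Fin (H + 1) → S, E.indicator (trajProb P π s0 H) τ

/-- Probability that the trajectory of `π` visits the state-action pair `(s,a)`. -/
noncomputable def visitProb [Fintype S] [DecidableEq S] (P : ℕ → S → A → S → ℝ)
    (π : ℕ → S → A) (s0 : S) (H : ℕ) (s : S) (a : A) : ℝ :=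
  probEvent P π s0 H {τ | ∃ h : Fin H, τ h.castSucc = s ∧ π h (τ h.castSucc) = a}

/-- A transition kernel is stochastic: nonnegative entries, rows summing to one. -/
def IsStochastic [Fintype S] (P : S → A → S → ℝ) : Prop :=
  (∀ s a s', 0 ≤ P s a s') ∧ ∀ s a, ∑ s' : S, P s a s' = 1

/-- The dynamics of `M∖(s,a)`: the terminal state `⊖` is modelled by `none`, is absorbing,
and taking action `a` at state `s` transitions deterministically to it. -/
def removeSA [DecidableEq S] [DecidableEq A] (P : S → A → S → ℝ) (s : S) (a : A) :
    Option S → A → Option S → ℝ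
  | none, _, y => if y = none then 1 else 0
  | some x, u, y =>
      if x = s ∧ u = a then (if y = none then 1 else 0)
      else Option.elim y 0 (fun y' => P x u y')

/-- Rewards lifted to `M∖(s,a)`: the terminal state carries zero reward. -/
def liftReward (r : S → A → ℝ) : Option S → A → ℝ
  | none, _ => 0
  | some x, u => r x u

/-- Backward-recursive value `V^{M,π}_h(s)` for time-dependent dynamics. -/
def Vpol [Fintype S] (P : ℕ → S → A → S → ℝ) (r : S → A → ℝ) (π : ℕ → S → A)
    (H : ℕ) (h : ℕ) (s : S) : ℝ :=
  if hlt : h < H then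
    r s (π h s) + ∑ s' : S, P h s (π h s) s' * Vpol P r π H (h + 1) s'
  else 0
termination_by H - h

theorem trajProb_nonneg [Fintype S] [DecidableEq S] {P : ℕ → S → A → S → ℝ}
    (hP : ∀ h, IsStochastic (P h)) (π : ℕ → S → A) (s0 : S) (H : ℕ) (τ : Fin (H + 1) → S) :
    0 ≤ trajProb P π s0 H τ :=
  mul_nonneg (by split_ifs <;> norm_num) (prod_nonneg fun h _ => (hP h).1 _ _ _)

theorem trajProb_snoc [Fintype S] [DecidableEq S] (P : ℕ → S → A → S → ℝ)
    (π : ℕ → S → A) (s0 : S) (H : ℕ) (τ : Fin (H + 1) → S) (s : S) :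
    trajProb P π s0 (H + 1) (Fin.snoc (α := fun _ => S) τ s) =
      trajProb P π s0 H τ * P H (τ (Fin.last H)) (π H (τ (Fin.last H))) s := by
  have h0 : Fin.snoc (α := fun _ => S) τ s 0 = τ 0 := Fin.snoc_castSucc (α := fun _ => S) s τ 0
  simp only [trajProb, h0, Fin.prod_univ_castSucc, Fin.succ_castSucc, Fin.snoc_castSucc,
    Fin.succ_last, Fin.snoc_last, Fin.val_castSucc, Fin.val_last, mul_assoc]

theorem sum_trajProb [Fintype S] [DecidableEq S] {P : ℕ → S → A → S → ℝ}
    (hP : ∀ h, IsStochastic (P h)) (π : ℕ → S → A) (s0 : S) (H : ℕ) :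
    ∑ τ, trajProb P π s0 H τ = 1 := by
  induction H with
  | zero =>
    rw [← (Equiv.funUnique (Fin 1) S).symm.sum_comp]
    simp [trajProb]
  | succ H ih =>
    rw [← (Fin.snocEquiv fun _ : Fin (H + 1 + 1) => S).sum_comp, Fintype.sum_prod_type_right]
    change ∑ τ : Fin (H + 1) → S, ∑ s,
      trajProb P π s0 (H + 1) (Fin.snoc (α := fun _ => S) τ s) = 1
    simp only [trajProb_snoc, ← mul_sum, (hP H).2, mul_one, ih]

theorem ret_mem_Icc {r : S → A → ℝ} (hr : ∀ s a, r s a ∈ Set.Icc (0 : ℝ) 1)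
    (π : ℕ → S → A) (H : ℕ) (τ : Fin (H + 1) → S) : ret r π H τ ∈ Set.Icc (0 : ℝ) H := by
  refine ⟨sum_nonneg fun _ _ => (hr _ _).1, ?_⟩
  calc ret r π H τ ≤ ∑ _h : Fin H, (1 : ℝ) := sum_le_sum fun _ _ => (hr _ _).2
    _ = H := by simp

theorem value_le_horizon [Fintype S] [DecidableEq S] {P : ℕ → S → A → S → ℝ}
    (hP : ∀ h, IsStochastic (P h)) {r : S → A → ℝ} (hr : ∀ s a, r s a ∈ Set.Icc (0 : ℝ) 1)
    (π : ℕ → S → A) (s0 : S) (H : ℕ) : value P r π s0 H ≤ H := by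
  calc value P r π s0 H ≤ ∑ τ, trajProb P π s0 H τ * H :=
        sum_le_sum fun τ _ => mul_le_mul_of_nonneg_left (ret_mem_Icc hr π H τ).2
          (trajProb_nonneg hP π s0 H τ)
    _ = H := by rw [← sum_mul, sum_trajProb hP, one_mul]

theorem value_le_optValue [Fintype S] [DecidableEq S] {P : ℕ → S → A → S → ℝ}
    (hP : ∀ h, IsStochastic (P h)) {r : S → A → ℝ} (hr : ∀ s a, r s a ∈ Set.Icc (0 : ℝ) 1)
    (π : ℕ → S → A) (s0 : S) (H : ℕ) : value P r π s0 H ≤ optValue P r s0 H :=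
  le_ciSup (f := fun π => value P r π s0 H)
    ⟨H, by rintro _ ⟨π, rfl⟩; exact value_le_horizon hP hr π s0 H⟩ π

theorem probEvent_add_compl [Fintype S] [DecidableEq S] {P : ℕ → S → A → S → ℝ}
    (hP : ∀ h, IsStochastic (P h)) (π : ℕ → S → A) (s0 : S) (H : ℕ)
    (E : Set (Fin (H + 1) → S)) : probEvent P π s0 H E + probEvent P π s0 H Eᶜ = 1 := by
  rw [probEvent, probEvent, ← sum_add_distrib, ← sum_trajProb hP π s0 H]
  exact sum_congr rfl fun τ _ => Set.indicator_self_add_compl_apply E _ τ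

/-- Two dynamics agreeing on all trajectories outside `E` give `E` the same probability. -/
theorem probEvent_eq_of_eqOn_compl [Fintype S] [DecidableEq S] {P P' : ℕ → S → A → S → ℝ}
    (hP : ∀ h, IsStochastic (P h)) (hP' : ∀ h, IsStochastic (P' h)) (π : ℕ → S → A) (s0 : S)
    (H : ℕ) {E : Set (Fin (H + 1) → S)}
    (hE : Set.EqOn (trajProb P π s0 H) (trajProb P' π s0 H) Eᶜ) :
    probEvent P π s0 H E = probEvent P' π s0 H E := by
  have hc : probEvent P π s0 H Eᶜ = probEvent P' π s0 H Eᶜ := by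
    rw [probEvent, probEvent, Set.indicator_congr hE]
  linarith [probEvent_add_compl hP π s0 H E, probEvent_add_compl hP' π s0 H E]

/-- If two dynamics agree on all trajectories outside `E`, the values of a policy differ by at
most `H` times the probability of `E`. -/
theorem value_sub_le_of_eqOn_compl [Fintype S] [DecidableEq S] {P P' : ℕ → S → A → S → ℝ}
    (hP : ∀ h, IsStochastic (P h)) (hP' : ∀ h, IsStochastic (P' h))
    {r : S → A → ℝ} (hr : ∀ s a, r s a ∈ Set.Icc (0 : ℝ) 1) (π : ℕ → S → A) (s0 : S)
    (H : ℕ) {E : Set (Fin (H + 1) → S)}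
    (hE : Set.EqOn (trajProb P π s0 H) (trajProb P' π s0 H) Eᶜ) :
    value P' r π s0 H - value P r π s0 H ≤ probEvent P' π s0 H E * H := by
  rw [value, value, probEvent, ← sum_sub_distrib, sum_mul]
  refine sum_le_sum fun τ _ => ?_
  obtain ⟨h0, h1⟩ := ret_mem_Icc hr π H τ
  by_cases hτ : τ ∈ E
  · rw [Set.indicator_of_mem hτ]
    exact (sub_le_self _ (mul_nonneg (trajProb_nonneg hP π s0 H τ) h0)).trans
      (mul_le_mul_of_nonneg_left h1 (trajProb_nonneg hP' π s0 H τ))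
  · rw [Set.indicator_of_notMem hτ, hE hτ, sub_self, zero_mul]

theorem trajProb_eqOn_compl_disagreement [Fintype S] [DecidableEq S]
    (P P' : ℕ → S → A → S → ℝ) (π : ℕ → S → A) (s0 : S) (H : ℕ) :
    Set.EqOn (trajProb P π s0 H) (trajProb P' π s0 H)
      {τ | ∃ h : Fin H, P h (τ h.castSucc) (π h (τ h.castSucc)) ≠
        P' h (τ h.castSucc) (π h (τ h.castSucc))}ᶜ := by
  intro τ hτ
  simp only [Set.mem_compl_iff, Set.mem_ofPred_eq, not_exists, not_not] at hτ
  simp only [trajProb, hτ]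

/-- If a policy's value in `M'` exceeds the optimal value of `M` by more
than `ρ`, then the trajectory of `π` meets the disagreement set
`Δ = {(s,a,h) : P_h(·|s,a) ≠ P'_h(·|s,a)}` with the same probability under `M` and `M'`,
and this probability is greater than `ρ/H`. -/
theorem value_gap_implies_visitation
    {S A : Type} [Fintype S] [DecidableEq S] [Nonempty S]
    [Fintype A] [DecidableEq A] [Nonempty A]
    (P P' : ℕ → S → A → S → ℝ) (hP : ∀ h, IsStochastic (P h)) (hP' : ∀ h, IsStochastic (P' h))
    (r : S → A → ℝ) (hr : ∀ s a, r s a ∈ Set.Icc (0 : ℝ) 1)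
    (H : ℕ) (s0 : S) (π : ℕ → S → A) (ρ : ℝ) (hρ : 0 < ρ)
    (hgap : value P' r π s0 H - optValue P r s0 H > ρ) :
    probEvent P π s0 H
        {τ | ∃ h : Fin H, P h (τ h.castSucc) (π h (τ h.castSucc)) ≠
          P' h (τ h.castSucc) (π h (τ h.castSucc))} =
      probEvent P' π s0 H
        {τ | ∃ h : Fin H, P h (τ h.castSucc) (π h (τ h.castSucc)) ≠
          P' h (τ h.castSucc) (π h (τ h.castSucc))} ∧
    probEvent P π s0 H
        {τ | ∃ h : Fin H, P h (τ h.castSucc) (π h (τ h.castSucc)) ≠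
          P' h (τ h.castSucc) (π h (τ h.castSucc))} > ρ / H := by
  have hE := trajProb_eqOn_compl_disagreement P P' π s0 H
  have heq := probEvent_eq_of_eqOn_compl hP hP' π s0 H hE
  refine ⟨heq, ?_⟩
  have hlt := value_sub_le_of_eqOn_compl hP hP' hr π s0 H hE
  have hopt := value_le_optValue hP hr π s0 H
  rw [← heq] at hlt
  have hH : 0 < (H : ℝ) := by
    rcases Nat.eq_zero_or_pos H with rfl | h
    · norm_num at hlt
      linarith
    · exact_mod_cast h
  rw [gt_iff_lt, div_lt_iff₀ hH]
  linarith

end MDPform
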